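/- arXiv:1603.08341 — 3 statements merged into one kernel-verified Lean document; each statement's English description precedes it below -/
import Mathlib

section
/- For every bounded lattice A there exists a canonical extension of A; that is, there exist a complete lattice C and an injective map e : A → C preserving binary meets, binary joins, ⊥ and ⊤, such that e is dense and compact. (This holds constructively, via the filter–ideal polarity construction, without any use of the axiom of choice.) -/
/-- `e : A → C` realizes the complete lattice `C` as a canonical extension of the
bounded lattice `A`: `e` is an injective bounded-lattice embedding which is dense
(every element of `C` is both a supremum of infima and an infimum of suprema of
subsets of the image of `e`) and compact. -/
structure IsCanonicalExtension {A C : Type*} [Lattice A] [BoundedOrder A]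
    [CompleteLattice C] (e : A → C) : Prop where
  injective : Function.Injective e
  map_inf : ∀ a b : A, e (a ⊓ b) = e a ⊓ e b
  map_sup : ∀ a b : A, e (a ⊔ b) = e a ⊔ e b
  map_bot : e ⊥ = ⊥
  map_top : e ⊤ = ⊤
  dense_sup : ∀ u : C, ∃ 𝒮 : Set (Set A), u = ⨆ S ∈ 𝒮, ⨅ a ∈ S, e a
  dense_inf : ∀ u : C, ∃ 𝒮 : Set (Set A), u = ⨅ S ∈ 𝒮, ⨆ a ∈ S, e a
  compact : ∀ S T : Set A, (⨆ a ∈ S, e a) ≤ (⨅ a ∈ T, e a) →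
      ∃ S' T' : Finset A, (S' : Set A) ⊆ S ∧ (T' : Set A) ⊆ T ∧
        (⨆ a ∈ S', e a) ≤ ⨅ a ∈ T', e a

open Order

universe u

section FilterIdeal

variable {A : Type u} [Lattice A]

/-- The polarity between filters and ideals: a filter and an ideal are related when they meet. -/
def FilterMeetsIdeal (F : PFilter A) (I : Ideal A) : Prop :=
  ∃ a, a ∈ F ∧ a ∈ I

/-- The complete lattice of Galois-closed sets of the filter–ideal polarity. -/
abbrev FilterIdealConcept (A : Type u) [Lattice A] : Type u :=
  Concept (PFilter A) (Ideal A) FilterMeetsIdeal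

namespace FilterIdealConcept

/-- The concept of all filters and all ideals containing a given element. -/
@[simps]
def of (a : A) : FilterIdealConcept A where
  extent := {F | a ∈ F}
  intent := {I | a ∈ I}
  upperPolar_extent := by
    ext I
    refine ⟨fun h => ?_, fun h F hF => ⟨a, hF, h⟩⟩
    obtain ⟨b, hab, hb⟩ := h (a := PFilter.principal a) (PFilter.mem_principal.2 le_rfl)
    exact I.lower hab hb
  lowerPolar_intent := by
    ext F
    refine ⟨fun h => ?_, fun h I hI => ⟨a, h, hI⟩⟩
    obtain ⟨b, hb, hba⟩ := h (b := Ideal.principal a) (Ideal.mem_principal.2 le_rfl)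
    exact PFilter.mem_of_le hba hb

theorem of_le_of {a b : A} : of a ≤ of b ↔ a ≤ b := by
  rw [← Concept.extent_subset_extent_iff]
  exact ⟨fun h => h (a := PFilter.principal a) (PFilter.mem_principal.2 le_rfl),
    fun h _ hF => PFilter.mem_of_le h hF⟩

theorem of_injective : Function.Injective (of : A → FilterIdealConcept A) := fun _ _ h =>
  le_antisymm (of_le_of.1 h.le) (of_le_of.1 h.ge)

theorem of_inf (a b : A) : of (a ⊓ b) = of a ⊓ of b :=
  Concept.ext (Set.ext fun _ => PFilter.inf_mem_iff)

theorem of_sup (a b : A) : of (a ⊔ b) = of a ⊔ of b :=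
  Concept.ext' (Set.ext fun _ => Ideal.sup_mem_iff)

theorem of_top [OrderTop A] : of (⊤ : A) = ⊤ :=
  Concept.ext (Set.eq_univ_of_forall fun _ => PFilter.top_mem)

theorem of_bot [OrderBot A] : of (⊥ : A) = ⊥ :=
  Concept.ext' (Set.eq_univ_of_forall fun I => I.bot_mem)

theorem mem_extent_iInf_of {S : Set A} {F : PFilter A} :
    F ∈ (⨅ a ∈ S, of a).extent ↔ S ⊆ F := by
  simp [Concept.extent_iInf, Set.subset_def]

theorem mem_intent_iSup_of {T : Set A} {I : Ideal A} :
    I ∈ (⨆ a ∈ T, of a).intent ↔ T ⊆ I := by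
  simp [Concept.intent_iSup, Set.subset_def]

theorem mem_extent_of_le (u : FilterIdealConcept A) {F G : PFilter A} (hF : F ∈ u.extent)
    (hFG : F ≤ G) : G ∈ u.extent := by
  rw [← u.lowerPolar_intent]
  intro I hI
  obtain ⟨a, haF, haI⟩ := u.rel_extent_intent hF hI
  exact ⟨a, hFG haF, haI⟩

theorem mem_intent_of_le (u : FilterIdealConcept A) {I J : Ideal A} (hI : I ∈ u.intent)
    (hIJ : I ≤ J) : J ∈ u.intent := by
  rw [← u.upperPolar_extent]
  intro F hF
  obtain ⟨a, haF, haI⟩ := u.rel_extent_intent hF hI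
  exact ⟨a, haF, hIJ haI⟩

theorem eq_iSup_iInf_of (u : FilterIdealConcept A) :
    u = ⨆ S ∈ SetLike.coe '' u.extent, ⨅ a ∈ S, of a := by
  rw [iSup_image]
  apply le_antisymm
  · rw [← Concept.extent_subset_extent_iff]
    intro F hF
    exact Concept.extent_subset_extent_iff.2
      (le_iSup₂ (f := fun (F : PFilter A) (_ : F ∈ u.extent) => ⨅ a ∈ (F : Set A), of a) F hF)
      (mem_extent_iInf_of.2 subset_rfl)
  · refine iSup₂_le fun F hF => Concept.extent_subset_extent_iff.1 fun G hG => ?_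
    exact u.mem_extent_of_le hF (mem_extent_iInf_of.1 hG)

theorem eq_iInf_iSup_of (u : FilterIdealConcept A) :
    u = ⨅ T ∈ SetLike.coe '' u.intent, ⨆ a ∈ T, of a := by
  rw [iInf_image]
  apply le_antisymm
  · refine le_iInf₂ fun I hI => Concept.intent_subset_intent_iff.1 fun J hJ => ?_
    exact u.mem_intent_of_le hI (mem_intent_iSup_of.1 hJ)
  · rw [← Concept.intent_subset_intent_iff]
    intro I hI
    exact Concept.intent_subset_intent_iff.2
      (iInf₂_le (f := fun (I : Ideal A) (_ : I ∈ u.intent) => ⨆ a ∈ (I : Set A), of a) I hI)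
      (mem_intent_iSup_of.2 subset_rfl)

end FilterIdealConcept

/-- The set of elements above a finite meet of elements of `S` is a filter. -/
theorem isPFilter_setOf_finset_inf_le [OrderTop A] (S : Set A) :
    IsPFilter {c : A | ∃ S' : Finset A, (S' : Set A) ⊆ S ∧ S'.inf id ≤ c} := by
  classical
  refine .of_def ⟨⊤, ∅, by simp⟩ ?_ fun h ⟨S', hS', hle⟩ => ⟨S', hS', hle.trans h⟩
  rintro x ⟨X, hX, hx⟩ y ⟨Y, hY, hy⟩
  refine ⟨x ⊓ y, ⟨X ∪ Y, by simp [hX, hY], ?_⟩, inf_le_left, inf_le_right⟩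
  rw [Finset.inf_union]
  exact inf_le_inf hx hy

/-- The set of elements below a finite join of elements of `T` is an ideal. -/
theorem isIdeal_setOf_le_finset_sup [OrderBot A] (T : Set A) :
    IsIdeal {c : A | ∃ T' : Finset A, (T' : Set A) ⊆ T ∧ c ≤ T'.sup id} := by
  classical
  refine ⟨fun _ _ h ⟨T', hT', hle⟩ => ⟨T', hT', h.trans hle⟩, ⟨⊥, ∅, by simp⟩, ?_⟩
  rintro x ⟨X, hX, hx⟩ y ⟨Y, hY, hy⟩
  refine ⟨x ⊔ y, ⟨X ∪ Y, by simp [hX, hY], ?_⟩, le_sup_left, le_sup_right⟩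
  rw [Finset.sup_union]
  exact sup_le_sup hx hy

/-- If a meet of embedded elements lies below a join of embedded elements, then already a finite
submeet lies below a finite subjoin. -/
theorem FilterIdealConcept.exists_finset_iInf_of_le_iSup_of [BoundedOrder A] {S T : Set A}
    (h : ⨅ a ∈ S, of a ≤ ⨆ a ∈ T, of a) :
    ∃ S' T' : Finset A, (S' : Set A) ⊆ S ∧ (T' : Set A) ⊆ T ∧
      ⨅ a ∈ S', of a ≤ ⨆ a ∈ T', of a := by
  have hF : (isPFilter_setOf_finset_inf_le S).toPFilter ∈ (⨅ a ∈ S, of a).extent :=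
    mem_extent_iInf_of.2 fun a ha => ⟨{a}, by simpa using ha, by simp⟩
  have hI : (isIdeal_setOf_le_finset_sup T).toIdeal ∈ (⨆ a ∈ T, of a).intent :=
    mem_intent_iSup_of.2 fun a ha => ⟨{a}, by simpa using ha, by simp⟩
  obtain ⟨c, ⟨S', hS', hc⟩, T', hT', hc'⟩ :=
    Concept.rel_extent_intent (Concept.extent_subset_extent_iff.2 h hF) hI
  refine ⟨S', T', hS', hT', ?_⟩
  have hinf : of (S'.inf id) = ⨅ a ∈ S', of a := by
    rw [Finset.apply_inf_eq_inf_comp of of_inf of_top, Finset.inf_eq_iInf]; rfl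
  have hsup : of (T'.sup id) = ⨆ a ∈ T', of a := by
    rw [Finset.apply_sup_eq_sup_comp of of_sup of_bot, Finset.sup_eq_iSup]; rfl
  rw [← hinf, ← hsup]
  exact of_le_of.2 (hc.trans hc')

theorem FilterIdealConcept.isCanonicalExtension_of [BoundedOrder A] :
    IsCanonicalExtension (of : A → FilterIdealConcept A) where
  injective := of_injective
  map_inf := of_inf
  map_sup := of_sup
  map_bot := of_bot
  map_top := of_top
  dense_sup u := ⟨_, u.eq_iSup_iInf_of⟩
  dense_inf u := ⟨_, u.eq_iInf_iSup_of⟩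
  compact _ _ _ := ⟨∅, ∅, by simp⟩

end FilterIdeal

/-- Every bounded lattice has a canonical extension which is moreover compact in the sense that a
meet lying below a join can be witnessed by finitely many elements on each side. -/
theorem exists_isCanonicalExtension_and_iInf_le_iSup_compact (A : Type u) [Lattice A]
    [BoundedOrder A] :
    ∃ (C : Type u) (_ : CompleteLattice C) (e : A → C), IsCanonicalExtension e ∧
      ∀ S T : Set A, ⨅ a ∈ S, e a ≤ ⨆ a ∈ T, e a →
        ∃ S' T' : Finset A, (S' : Set A) ⊆ S ∧ (T' : Set A) ⊆ T ∧
          ⨅ a ∈ S', e a ≤ ⨆ a ∈ T', e a :=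
  ⟨FilterIdealConcept A, inferInstance, .of, FilterIdealConcept.isCanonicalExtension_of,
    fun _ _ => FilterIdealConcept.exists_finset_iInf_of_le_iSup_of⟩

/-- Every bounded lattice has a canonical extension (constructively, via the
filter–ideal polarity). -/
theorem canonical_extension_exists (A : Type) [Lattice A] [BoundedOrder A] :
    ∃ (C : Type) (instC : CompleteLattice C) (e : A → C),
      @IsCanonicalExtension A C _ _ instC e := by
  obtain ⟨C, instC, e, he, -⟩ := exists_isCanonicalExtension_and_iInf_le_iSup_compact A
  exact ⟨C, instC, e, he⟩
end

section
/- Let C be a complete lattice, let a₁, …, aₙ ∈ C, let β₁, …, β_m : C → C be monotone maps, and let γ₁, …, γ_m : C → C be antitone maps. Then β_j(a₁ ⊔ ⋯ ⊔ aₙ) ≤ γ_j(a₁ ⊔ ⋯ ⊔ aₙ) holds for all 1 ≤ j ≤ m if and only if there exists p ∈ C such that aᵢ ≤ p for all 1 ≤ i ≤ n and β_j(p) ≤ γ_j(p) for all 1 ≤ j ≤ m. -/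
/-- Right Ackermann Lemma (semantic form): for monotone maps `β j` and antitone
maps `γ j` on a complete lattice, the inequalities `β j (⨆ i, a i) ≤ γ j (⨆ i, a i)`
all hold iff there is some `p` with `a i ≤ p` for all `i` and `β j p ≤ γ j p` for
all `j`. -/
theorem right_ackermann_lemma {C : Type*} [CompleteLattice C] {n m : ℕ}
    (a : Fin n → C) (β γ : Fin m → C → C)
    (hβ : ∀ j, Monotone (β j)) (hγ : ∀ j, Antitone (γ j)) :
    (∀ j, β j (⨆ i, a i) ≤ γ j (⨆ i, a i)) ↔
      ∃ p : C, (∀ i, a i ≤ p) ∧ ∀ j, β j p ≤ γ j p := by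
  constructor
  · exact fun h => ⟨⨆ i, a i, le_iSup a, h⟩
  · rintro ⟨p, hap, hp⟩ j
    have hle : ⨆ i, a i ≤ p := iSup_le hap
    exact (hβ j hle).trans ((hp j).trans (hγ j hle))
end

section
/- Let C be a complete lattice, let a₁, …, aₙ ∈ C, let β₁, …, β_m : C → C be antitone maps, and let γ₁, …, γ_m : C → C be monotone maps. Then β_j(a₁ ⊓ ⋯ ⊓ aₙ) ≤ γ_j(a₁ ⊓ ⋯ ⊓ aₙ) holds for all 1 ≤ j ≤ m if and only if there exists p ∈ C such that p ≤ aᵢ for all 1 ≤ i ≤ n and β_j(p) ≤ γ_j(p) for all 1 ≤ j ≤ m. -/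
/-- Left Ackermann Lemma (semantic form): for antitone maps `β j` and monotone
maps `γ j` on a complete lattice, the inequalities `β j (⨅ i, a i) ≤ γ j (⨅ i, a i)`
all hold iff there is some `p` with `p ≤ a i` for all `i` and `β j p ≤ γ j p` for
all `j`. -/
theorem left_ackermann_lemma {C : Type*} [CompleteLattice C] {n m : ℕ}
    (a : Fin n → C) (β γ : Fin m → C → C)
    (hβ : ∀ j, Antitone (β j)) (hγ : ∀ j, Monotone (γ j)) :
    (∀ j, β j (⨅ i, a i) ≤ γ j (⨅ i, a i)) ↔
      ∃ p : C, (∀ i, p ≤ a i) ∧ ∀ j, β j p ≤ γ j p := by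
  constructor
  · intro h
    exact ⟨⨅ i, a i, iInf_le a, h⟩
  · rintro ⟨p, hpa, hp⟩ j
    have hle : p ≤ ⨅ i, a i := le_iInf hpa
    exact (hβ j hle).trans ((hp j).trans (hγ j hle))
end
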